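/- arXiv:1601.07223 — 3 statements merged into one kernel-verified Lean document; each statement's English description precedes it below -/
import Mathlib

section
/- Let G ∈ ℂ^{p×n}, let ρ > 0, let N_S ≤ n, and let σ_1(G) ≥ σ_2(G) ≥ ⋯ ≥ σ_n(G) ≥ 0 be the singular values of G in nonincreasing order. Then for every semi-unitary Q ∈ ℂ^{n×N_S} (Q*Q = I_{N_S}), det(I_p + ρ G Q Q* G*) ≤ ∏_{ℓ=1}^{N_S} (1 + ρ σ_ℓ(G)²). -/
open Matrix
open scoped ComplexOrder

namespace Matrix

/-- A symmetrized form of the Cauchy–Binet formula. -/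
theorem factorial_mul_det_mul {m ι R : Type*} [Fintype m] [DecidableEq m] [Fintype ι]
    [CommRing R] (A : Matrix m ι R) (B : Matrix ι m R) :
    ((Fintype.card m).factorial : R) * (A * B).det =
      ∑ f : m → ι, (A.submatrix id f).det * (B.submatrix f id).det := by
  classical
  have expand : (A * B).det = ∑ f : m → ι, (∏ i, A i (f i)) * (B.submatrix f id).det := by
    have hrows : (A * B) = fun i => ∑ j, A i j • B j := by
      ext i k
      simp [mul_apply]
    calc (A * B).det = detRowAlternating (fun i => ∑ j, A i j • B j) := by rw [← hrows]; rfl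
      _ = ∑ f : m → ι, detRowAlternating (fun i => A i (f i) • B (f i)) :=
        (detRowAlternating (R := R) (n := m)).toMultilinearMap.map_sum
          (fun i j => A i j • B j)
      _ = _ := Finset.sum_congr rfl fun f _ =>
        (detRowAlternating (R := R) (n := m)).toMultilinearMap.map_smul_univ
          (fun i => A i (f i)) (fun i => B (f i))
  have permuted (π : Equiv.Perm m) : (A * B).det =
      ∑ f : m → ι, ((Equiv.Perm.sign π : ℤ) : R) * (∏ i, A i (f (π i))) *
        (B.submatrix f id).det := by
    rw [expand, ← (Equiv.arrowCongr π.symm (Equiv.refl ι)).sum_comp]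
    refine Finset.sum_congr rfl fun f _ => ?_
    have hdet : (B.submatrix (f ∘ π) id).det =
        ((Equiv.Perm.sign π : ℤ) : R) * (B.submatrix f id).det :=
      det_permute π (B.submatrix f id)
    have hf : Equiv.arrowCongr π.symm (Equiv.refl ι) f = f ∘ π := rfl
    rw [hf, hdet]
    simp only [Function.comp_apply]
    ring
  calc ((Fintype.card m).factorial : R) * (A * B).det
      = ∑ _π : Equiv.Perm m, (A * B).det := by
        rw [Finset.sum_const, Finset.card_univ, Fintype.card_perm, nsmul_eq_mul]
    _ = ∑ π : Equiv.Perm m, ∑ f : m → ι, ((Equiv.Perm.sign π : ℤ) : R) *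
          (∏ i, A i (f (π i))) * (B.submatrix f id).det :=
        Finset.sum_congr rfl fun π _ => permuted π
    _ = _ := by
        rw [Finset.sum_comm]
        refine Finset.sum_congr rfl fun f _ => ?_
        rw [← Finset.sum_mul, ← det_transpose (A.submatrix id f), det_apply' (A.submatrix id f)ᵀ]
        rfl

end Matrix

theorem StrictMono.castLE_le {n k : ℕ} {g : Fin k → Fin n} (hg : StrictMono g) (hk : k ≤ n)
    (i : Fin k) : Fin.castLE hk i ≤ g i := by
  obtain ⟨i, hi⟩ := i
  induction i with
  | zero => exact Nat.zero_le _
  | succ i ih =>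
    exact Nat.succ_le_of_lt
      ((ih (Nat.lt_of_succ_lt hi)).trans_lt (hg (Fin.mk_lt_mk.mpr i.lt_succ_self)))

theorem Antitone.prod_comp_le_prod_castLE {n k : ℕ} (hk : k ≤ n) {e : Fin n → ℝ}
    (he : Antitone e) (he0 : ∀ j, 0 ≤ e j) {f : Fin k → Fin n} (hf : Function.Injective f) :
    ∏ i, e (f i) ≤ ∏ i, e (Fin.castLE hk i) := by
  classical
  have hcard : (Finset.univ.image f).card = k := by
    rw [Finset.card_image_of_injective _ hf, Finset.card_univ, Fintype.card_fin]
  set g := (Finset.univ.image f).orderEmbOfFin hcard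
  have hg (i : Fin k) : Fin.castLE hk i ≤ g i :=
    g.strictMono.castLE_le hk i
  calc ∏ i, e (f i) = ∏ j ∈ Finset.univ.image f, e j :=
        (Finset.prod_image hf.injOn).symm
    _ = ∏ i, e (g i) := by
        rw [← Finset.prod_image g.injective.injOn, Finset.image_orderEmbOfFin_univ]
    _ ≤ _ := Finset.prod_le_prod (fun i _ => he0 _) fun i _ => he (hg i)

theorem Matrix.det_conjTranspose_mul_diagonal_mul_le {n k : ℕ} (hk : k ≤ n) {e : Fin n → ℝ}
    (he : Antitone e) (he0 : ∀ j, 0 ≤ e j) {W : Matrix (Fin n) (Fin k) ℂ} (hW : Wᴴ * W = 1) :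
    (Wᴴ * (diagonal (fun j => (e j : ℂ)) * W)).det ≤ ∏ i, (e (Fin.castLE hk i) : ℂ) := by
  have hpos : (0 : ℂ) < (Fintype.card (Fin k)).factorial := by
    exact_mod_cast Nat.factorial_pos _
  refine le_of_mul_le_mul_left ?_ hpos
  have hone : ∑ f : Fin k → Fin n, (Wᴴ.submatrix id f).det * (W.submatrix f id).det =
      (Fintype.card (Fin k)).factorial := by
    rw [← factorial_mul_det_mul, hW, det_one, mul_one]
  rw [factorial_mul_det_mul, ← hone, Finset.sum_mul]
  refine Finset.sum_le_sum fun f _ => ?_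
  have hdiag : ((diagonal (fun j => (e j : ℂ)) * W).submatrix f id).det =
      (∏ i, (e (f i) : ℂ)) * (W.submatrix f id).det := by
    rw [← det_mul_column]
    congr 1
    ext i j
    simp
  have hstar : (Wᴴ.submatrix id f).det = star (W.submatrix f id).det := by
    rw [← det_conjTranspose, conjTranspose_submatrix]
  rw [hdiag, hstar, mul_left_comm, mul_comm]
  by_cases hf : Function.Injective f
  · refine mul_le_mul_of_nonneg_left ?_ (star_mul_self_nonneg _)
    exact_mod_cast he.prod_comp_le_prod_castLE hk he0 hf
  · obtain ⟨i, j, hij, hne⟩ := Function.not_injective_iff.mp hf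
    have hzero : (W.submatrix f id).det = 0 :=
      det_zero_of_row_eq hne (by ext; simp [hij])
    simp [hzero]

/-- Poincaré-separation type bound.  If `G = U Σ Vᴴ` is an SVD of `G`
(`U`, `V` unitary, `Σ` rectangular diagonal with nonincreasing nonnegative entries `σ`),
then for every semi-unitary `Q ∈ ℂ^{n×N_S}`,
`det(I + ρ G Q Qᴴ Gᴴ) ≤ ∏_{ℓ=1}^{N_S} (1 + ρ σ_ℓ(G)²)`. -/
theorem det_le_prod_top_singular_values (p n N_S : ℕ)
    (G : Matrix (Fin p) (Fin n) ℂ) (ρ : ℝ) (hρ : 0 < ρ) (hNS : N_S ≤ n)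
    (σ : Fin n → ℝ) (hσ0 : ∀ ℓ, 0 ≤ σ ℓ) (hσmono : Antitone σ)
    (U : Matrix (Fin p) (Fin p) ℂ) (V : Matrix (Fin n) (Fin n) ℂ)
    (hU : Uᴴ * U = 1) (hU' : U * Uᴴ = 1)
    (hV : Vᴴ * V = 1) (hV' : V * Vᴴ = 1)
    (hSVD : G = U * (Matrix.of fun (i : Fin p) (j : Fin n) =>
        if (i : ℕ) = (j : ℕ) then (σ j : ℂ) else 0) * Vᴴ) :
    ∀ Q : Matrix (Fin n) (Fin N_S) ℂ, Qᴴ * Q = 1 →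
      ((1 : Matrix (Fin p) (Fin p) ℂ) + (ρ : ℂ) • (G * Q * (G * Q)ᴴ)).det
        ≤ ∏ ℓ : Fin N_S, ((1 + ρ * σ (Fin.castLE hNS ℓ) ^ 2 : ℝ) : ℂ) := by
  intro Q hQ
  set S : Matrix (Fin p) (Fin n) ℂ := Matrix.of fun (i : Fin p) (j : Fin n) =>
    if (i : ℕ) = (j : ℕ) then (σ j : ℂ) else 0 with hS
  let d : Fin n → ℝ := fun j => if (j : ℕ) < p then σ j ^ 2 else 0
  let e : Fin n → ℝ := fun j => 1 + ρ * d j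
  have hd0 (j : Fin n) : 0 ≤ d j := by dsimp only [d]; split_ifs <;> positivity
  have hdle (j : Fin n) : d j ≤ σ j ^ 2 := by
    dsimp only [d]; split_ifs <;> [exact le_rfl; positivity]
  have hd : Antitone d := by
    intro i j hij
    by_cases hj : (j : ℕ) < p
    · have hi : (i : ℕ) < p := lt_of_le_of_lt hij hj
      simpa [d, hi, hj] using pow_le_pow_left₀ (hσ0 j) (hσmono hij) 2
    · simpa [d, hj] using hd0 i
  have he : Antitone e := fun i j hij =>
    add_le_add_right (mul_le_mul_of_nonneg_left (hd hij) hρ.le) 1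
  have he0 (j : Fin n) : 0 ≤ e j := by have := hd0 j; positivity
  have hSS : Sᴴ * S = diagonal (fun j => (d j : ℂ)) := by
    ext i j
    simp only [hS, mul_apply, conjTranspose_apply, of_apply, diagonal_apply, d]
    by_cases hi : (i : ℕ) < p
    · rw [Finset.sum_eq_single (⟨i, hi⟩ : Fin p)]
      · by_cases hij : i = j
        · subst hij; simp [hi, sq]
        · simp [hij, Fin.val_inj]
      · intro b _ hb
        have : (b : ℕ) ≠ i := fun h => hb (Fin.ext h)
        simp [this]
      · simp
    · have h (b : Fin p) : (b : ℕ) ≠ i := fun h => hi (h ▸ b.isLt)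
      simp [h, hi]
  set W := Vᴴ * Q with hWdef
  have hW : Wᴴ * W = 1 := by
    rw [hWdef, conjTranspose_mul, conjTranspose_conjTranspose, Matrix.mul_assoc,
      ← Matrix.mul_assoc V, hV', Matrix.one_mul, hQ]
  have hGQ : G * Q = U * (S * W) := by rw [hSVD, hWdef]; simp only [Matrix.mul_assoc]
  have hgram : (G * Q)ᴴ * (G * Q) = Wᴴ * (diagonal (fun j => (d j : ℂ)) * W) := by
    rw [hGQ, conjTranspose_mul, Matrix.mul_assoc, ← Matrix.mul_assoc Uᴴ, hU, Matrix.one_mul,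
      conjTranspose_mul, Matrix.mul_assoc, ← Matrix.mul_assoc Sᴴ, hSS]
  have hdiag : diagonal (fun j => (e j : ℂ)) =
      1 + (ρ : ℂ) • diagonal (fun j => (d j : ℂ)) := by
    rw [← diagonal_one, ← diagonal_smul, diagonal_add]
    simp [e]
  have hdet : ((1 : Matrix (Fin p) (Fin p) ℂ) + (ρ : ℂ) • (G * Q * (G * Q)ᴴ)).det =
      (Wᴴ * (diagonal (fun j => (e j : ℂ)) * W)).det := by
    rw [← Matrix.smul_mul, det_one_add_mul_comm, Matrix.mul_smul, hgram, hdiag, Matrix.add_mul,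
      Matrix.mul_add, Matrix.one_mul, hW, Matrix.smul_mul, Matrix.mul_smul]
  rw [hdet]
  refine (det_conjTranspose_mul_diagonal_mul_le hNS he he0 hW).trans ?_
  have hprod : ∏ i, e (Fin.castLE hNS i) ≤ ∏ i, (1 + ρ * σ (Fin.castLE hNS i) ^ 2) :=
    Finset.prod_le_prod (fun i _ => he0 _) fun i _ =>
      add_le_add_right (mul_le_mul_of_nonneg_left (hdle _) hρ.le) 1
  exact_mod_cast hprod
end

section
/- Let G ∈ ℂ^{p×n} with singular value decomposition G = Ū Σ̄ V̄*, where Ū is semi-unitary, V̄ ∈ ℂ^{n×n} is unitary, and Σ̄ is rectangular diagonal with diagonal entries σ_1(G) ≥ ⋯ ≥ σ_n(G) ≥ 0. Let ρ > 0, N_S ≤ n, and let Q = [V̄]_{:,1:N_S} be the first N_S columns of V̄. Then Q is semi-unitary and det(I_p + ρ G Q Q* G*) = ∏_{ℓ=1}^{N_S} (1 + ρ σ_ℓ(G)²). -/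
open Matrix
open scoped ComplexOrder

/-- The Gram matrix of the columns of `V` selected by an injective map `f`, after applying
`U * diagonal d * Vᴴ`, is diagonal. -/
lemma conjTranspose_mul_self_svd_mul_submatrix {l m n : Type*} [Fintype l] [DecidableEq l]
    [Fintype m] [Fintype n] [DecidableEq n] {U : Matrix m n ℂ} {V : Matrix n n ℂ}
    (hU : Uᴴ * U = 1) (hV : Vᴴ * V = 1) (d : n → ℂ) {f : l → n} (hf : Function.Injective f) :
    (U * diagonal d * Vᴴ * V.submatrix id f)ᴴ * (U * diagonal d * Vᴴ * V.submatrix id f) =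
      diagonal fun i => star (d (f i)) * d (f i) := by
  have hcols : U * diagonal d * Vᴴ * V.submatrix id f = (U * diagonal d).submatrix id f := by
    have h : (U * diagonal d * Vᴴ * V).submatrix id f =
        U * diagonal d * Vᴴ * V.submatrix id f :=
      submatrix_mul _ _ _ _ _ Function.bijective_id
    rw [← h, Matrix.mul_assoc _ Vᴴ, hV, Matrix.mul_one]
  rw [hcols, conjTranspose_submatrix, ← submatrix_mul _ _ _ _ _ Function.bijective_id,
    conjTranspose_mul, Matrix.mul_assoc, ← Matrix.mul_assoc Uᴴ, hU, Matrix.one_mul,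
    diagonal_conjTranspose, diagonal_mul_diagonal, submatrix_diagonal _ _ hf]
  rfl

/-- achievability.  If `G = Ū Σ̄ V̄ᴴ` is a (thin) SVD of `G` (`Ū` semi-unitary,
`V̄` unitary, `Σ̄ = diag σ` with nonincreasing nonnegative `σ`) and `Q` consists of the first
`N_S` columns of `V̄`, then `Q` is semi-unitary and
`det(I + ρ G Q Qᴴ Gᴴ) = ∏_{ℓ=1}^{N_S} (1 + ρ σ_ℓ(G)²)`. -/
theorem det_eq_prod_top_singular_values_of_dominant_right_singular_vectors
    (p n N_S : ℕ) (G : Matrix (Fin p) (Fin n) ℂ)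
    (Ubar : Matrix (Fin p) (Fin n) ℂ) (Vbar : Matrix (Fin n) (Fin n) ℂ)
    (σ : Fin n → ℝ)
    (hU : Ubarᴴ * Ubar = 1)
    (hV : Vbarᴴ * Vbar = 1) (hV' : Vbar * Vbarᴴ = 1)
    (hσ0 : ∀ ℓ, 0 ≤ σ ℓ) (hσmono : Antitone σ)
    (hSVD : G = Ubar * Matrix.diagonal (fun ℓ => (σ ℓ : ℂ)) * Vbarᴴ)
    (ρ : ℝ) (hρ : 0 < ρ) (hNS : N_S ≤ n) :
    let Q : Matrix (Fin n) (Fin N_S) ℂ := Vbar.submatrix id (Fin.castLE hNS)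
    Qᴴ * Q = 1 ∧
      ((1 : Matrix (Fin p) (Fin p) ℂ) + (ρ : ℂ) • (G * Q * (G * Q)ᴴ)).det
        = ∏ ℓ : Fin N_S, ((1 + ρ * σ (Fin.castLE hNS ℓ) ^ 2 : ℝ) : ℂ) := by
  intro Q
  have hf : Function.Injective (Fin.castLE hNS) := Fin.castLE_injective hNS
  refine ⟨?_, ?_⟩
  · rw [conjTranspose_submatrix, ← submatrix_mul _ _ _ _ _ Function.bijective_id, hV,
      submatrix_one _ hf]
  · rw [← Matrix.smul_mul, det_one_add_mul_comm, Matrix.mul_smul, hSVD,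
      conjTranspose_mul_self_svd_mul_submatrix hU hV _ hf, ← diagonal_smul, ← diagonal_one,
      diagonal_add, det_diagonal]
    refine Finset.prod_congr rfl fun i _ => ?_
    simp [sq]
end

section
/- Let H ∈ ℂ^{N_MS×N_BS} with singular value decomposition H = U Σ V* (U, V unitary, Σ rectangular diagonal with nonincreasing nonnegative diagonal entries), let N_S ≤ min(N_MS, N_BS), and let Σ̃ = [Σ]_{:,1:N_S} and Ṽ = [V]_{:,1:N_S} collect the first N_S columns of Σ and V respectively. Let P ∈ ℂ^{N_BS×N_BS} be any Hermitian positive semidefinite matrix (in particular, an orthogonal projection F(F*F)^{-1}F*), and let ρ > 0. Then det(I_{N_MS} + ρ H P H*) ≥ det(I_{N_S} + ρ Σ̃* Ṽ* P Ṽ Σ̃), i.e., truncating the channel to its N_S dominant singular directions lower-bounds the mutual information. -/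
open Matrix
open scoped ComplexOrder

namespace Matrix

/-- The determinant of the identity plus a positive semidefinite matrix is at least one. -/
theorem PosSemidef.one_le_det_one_add {n : Type*} [Fintype n] [DecidableEq n]
    {A : Matrix n n ℂ} (hA : A.PosSemidef) : 1 ≤ (1 + A).det := by
  have hdet : (1 + A).det = ∏ i, (1 + (hA.isHermitian.eigenvalues i : ℂ)) := by
    have h := eval_charpoly A (-1)
    have hneg : scalar n (-1 : ℂ) - A = -(1 + A) := by
      rw [map_neg, map_one, neg_add, sub_eq_add_neg]
    have hprod : ∏ i, (-1 - (hA.isHermitian.eigenvalues i : ℂ)) =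
        (-1) ^ Fintype.card n * ∏ i, (1 + (hA.isHermitian.eigenvalues i : ℂ)) := by
      rw [← Finset.card_univ, ← Finset.prod_const, ← Finset.prod_mul_distrib]
      exact Finset.prod_congr rfl fun i _ => by ring
    rw [hneg, det_neg, hA.isHermitian.charpoly_eq, Polynomial.eval_prod] at h
    simp only [Polynomial.eval_sub, Polynomial.eval_X, Polynomial.eval_C] at h
    exact (mul_left_cancel₀ (pow_ne_zero _ (by norm_num)) (hprod.symm.trans h)).symm
  have hreal : (1 : ℝ) ≤ ∏ i, (1 + hA.isHermitian.eigenvalues i) :=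
    Finset.one_le_prod fun i _ => le_add_of_nonneg_right (hA.eigenvalues_nonneg i)
  rw [hdet]
  exact_mod_cast hreal

/-- Passing from a positive semidefinite block matrix to its top left block does not increase
`det (1 + ·)`. -/
theorem PosSemidef.det_one_add_toBlocks₁₁_le {m n : Type*} [Fintype m] [DecidableEq m]
    [Fintype n] [DecidableEq n] {M : Matrix (m ⊕ n) (m ⊕ n) ℂ} (hM : M.PosSemidef) :
    (1 + M.toBlocks₁₁).det ≤ (1 + M).det := by
  have hA : (1 + M.toBlocks₁₁).PosDef := PosDef.one.add_posSemidef (hM.submatrix Sum.inl)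
  have := hA.isUnit.invertible
  have hC : M.toBlocks₂₁ = M.toBlocks₁₂ᴴ := by
    ext i j
    exact (hM.isHermitian.apply _ _).symm
  have hSchur :
      (M.toBlocks₂₂ - M.toBlocks₁₂ᴴ * (1 + M.toBlocks₁₁)⁻¹ * M.toBlocks₁₂).PosSemidef := by
    rw [← PosDef.fromBlocks₁₁ _ _ hA]
    have hdiag : (fromBlocks (1 : Matrix m m ℂ) 0 0 (0 : Matrix n n ℂ)).PosSemidef := by
      rw [← diagonal_one, ← diagonal_zero, fromBlocks_diagonal]
      refine PosSemidef.diagonal ?_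
      rintro (i | i) <;> simp
    have hsum := hdiag.add hM
    rw [← fromBlocks_toBlocks M, hC, fromBlocks_add] at hsum
    simpa using hsum
  have hM1 : 1 + M = fromBlocks (1 + M.toBlocks₁₁) M.toBlocks₁₂ M.toBlocks₁₂ᴴ
      (1 + M.toBlocks₂₂) := by
    conv_lhs => rw [← fromBlocks_toBlocks M, hC, ← fromBlocks_one, fromBlocks_add]
    simp
  rw [hM1, det_fromBlocks₁₁, invOf_eq_nonsing_inv, add_sub_assoc]
  exact le_mul_of_one_le_right hA.det_pos.le hSchur.one_le_det_one_add

/-- Passing from a positive semidefinite matrix to a principal submatrix does not increase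
`det (1 + ·)`. -/
theorem PosSemidef.det_one_add_submatrix_le {m n : Type*} [Fintype m] [DecidableEq m]
    [Fintype n] [DecidableEq n] {M : Matrix n n ℂ} (hM : M.PosSemidef) {e : m → n}
    (he : Function.Injective e) : (1 + M.submatrix e e).det ≤ (1 + M).det := by
  classical
  let f : m ⊕ ((Set.range e)ᶜ : Set n) ≃ n :=
    ((Equiv.ofInjective e he).sumCongr (Equiv.refl _)).trans (Equiv.Set.sumCompl _)
  have h := (hM.submatrix f).det_one_add_toBlocks₁₁_le
  rw [← submatrix_one_equiv f, ← Pi.add_apply, ← Pi.add_apply, ← submatrix_add,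
    det_submatrix_equiv_self] at h
  exact h

end Matrix

/-- truncating the channel to its `N_S` dominant singular directions
lower-bounds the mutual information.  With `H = U Σ Vᴴ` an SVD (`U`, `V` unitary, `Σ`
rectangular diagonal with nonincreasing nonnegative entries `σ`), `Σ̃` the leading
`N_S`-column (equivalently, leading `N_S × N_S`) block of `Σ`, `Ṽ` the first `N_S`
columns of `V`, and `P` Hermitian positive semidefinite,
`det(I_{N_MS} + ρ H P Hᴴ) ≥ det(I_{N_S} + ρ Σ̃ᴴ Ṽᴴ P Ṽ Σ̃)`.
(Note: the nonzero content of `[Σ]_{:,1:N_S}` lies in its top `N_S × N_S` block, which is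
the square diagonal block used here so that the product `Σ̃ᴴ Ṽᴴ P Ṽ Σ̃` is well-typed.) -/
theorem truncated_channel_lower_bound (N_MS N_BS N_S : ℕ)
    (H : Matrix (Fin N_MS) (Fin N_BS) ℂ)
    (U : Matrix (Fin N_MS) (Fin N_MS) ℂ) (V : Matrix (Fin N_BS) (Fin N_BS) ℂ)
    (σ : ℕ → ℝ)
    (hU : Uᴴ * U = 1) (hU' : U * Uᴴ = 1)
    (hV : Vᴴ * V = 1) (hV' : V * Vᴴ = 1)
    (hσ0 : ∀ k, 0 ≤ σ k) (hσmono : Antitone σ)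
    (hSVD : H = U * (Matrix.of fun (i : Fin N_MS) (j : Fin N_BS) =>
        if (i : ℕ) = (j : ℕ) then (σ (j : ℕ) : ℂ) else 0) * Vᴴ)
    (hNS1 : N_S ≤ N_MS) (hNS2 : N_S ≤ N_BS)
    (P : Matrix (Fin N_BS) (Fin N_BS) ℂ) (hP : P.PosSemidef)
    (ρ : ℝ) (hρ : 0 < ρ) :
    let Strunc : Matrix (Fin N_S) (Fin N_S) ℂ :=
      (Matrix.of fun (i : Fin N_MS) (j : Fin N_BS) =>
        if (i : ℕ) = (j : ℕ) then (σ (j : ℕ) : ℂ) else 0).submatrix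
        (Fin.castLE hNS1) (Fin.castLE hNS2)
    let Vt : Matrix (Fin N_BS) (Fin N_S) ℂ := V.submatrix id (Fin.castLE hNS2)
    ((1 : Matrix (Fin N_S) (Fin N_S) ℂ) + (ρ : ℂ) • (Struncᴴ * Vtᴴ * P * Vt * Strunc)).det
      ≤ ((1 : Matrix (Fin N_MS) (Fin N_MS) ℂ) + (ρ : ℂ) • (H * P * Hᴴ)).det := by
  intro Strunc Vt
  set S : Matrix (Fin N_MS) (Fin N_BS) ℂ := Matrix.of fun i j =>
    if (i : ℕ) = (j : ℕ) then (σ (j : ℕ) : ℂ) else 0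
  have hM : ((ρ : ℂ) • (S * Vᴴ * P * (S * Vᴴ)ᴴ)).PosSemidef :=
    (hP.mul_mul_conjTranspose_same _).smul (by exact_mod_cast hρ.le)
  have hfull : (1 + (ρ : ℂ) • (H * P * Hᴴ)).det =
      (1 + (ρ : ℂ) • (S * Vᴴ * P * (S * Vᴴ)ᴴ)).det := by
    have hconj : 1 + (ρ : ℂ) • (H * P * Hᴴ) =
        U * (1 + (ρ : ℂ) • (S * Vᴴ * P * (S * Vᴴ)ᴴ)) * Uᴴ := by
      simp only [hSVD, conjTranspose_mul, Matrix.mul_add, Matrix.add_mul, Matrix.mul_one, hU',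
        Matrix.mul_smul, Matrix.smul_mul, Matrix.mul_assoc]
    rw [hconj, det_mul_right_comm, hU', Matrix.one_mul]
  have hStrunc : Struncᴴ = Strunc := by
    ext i j
    by_cases h : (i : ℕ) = j
    · simp [Strunc, h]
    · simp [Strunc, h, Ne.symm h]
  have hrow : (S * Vᴴ).submatrix (Fin.castLE hNS1) id = Strunc * Vtᴴ := by
    ext i j
    simp only [submatrix_apply, mul_apply, conjTranspose_apply, Strunc, Vt, S, of_apply, id]
    rw [Finset.sum_eq_single (Fin.castLE hNS2 i), Finset.sum_eq_single i]
    · intro k _ hk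
      simp [Fin.val_ne_of_ne hk.symm]
    · simp
    · intro k _ hk
      have hik : (i : ℕ) ≠ k := fun h => hk (Fin.ext h.symm)
      simp [hik]
    · simp
  have hsub : ((ρ : ℂ) • (S * Vᴴ * P * (S * Vᴴ)ᴴ)).submatrix (Fin.castLE hNS1)
      (Fin.castLE hNS1) = (ρ : ℂ) • (Struncᴴ * Vtᴴ * P * Vt * Strunc) := by
    have hprod : (S * Vᴴ * P * (S * Vᴴ)ᴴ).submatrix (Fin.castLE hNS1) (Fin.castLE hNS1) =
        (S * Vᴴ).submatrix (Fin.castLE hNS1) id * P *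
          ((S * Vᴴ).submatrix (Fin.castLE hNS1) id)ᴴ := rfl
    rw [submatrix_smul, Pi.smul_apply, Pi.smul_apply, hprod, hrow, conjTranspose_mul,
      conjTranspose_conjTranspose, hStrunc]
    simp only [Matrix.mul_assoc]
  rw [hfull, ← hsub]
  exact hM.det_one_add_submatrix_le (Fin.castLE_injective hNS1)
end
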